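/- The topological complexity of the 2-dimensional Klein bottle K_2 equals 5; that is, K_2 × K_2 admits a motion planning cover of size 5 but admits no motion planning cover of size 4. -/

import Mathlib

open Set

namespace Paper

/-- `X` admits a motion planning cover of size `k`: an open cover of `X × X` by `k`
open sets, each admitting a continuous section of the path fibration
`π_X : C(I, X) → X × X`, `γ ↦ (γ 0, γ 1)`. -/
def HasMPCover (X : Type*) [TopologicalSpace X] (k : ℕ) : Prop :=
  ∃ U : Fin k → Set (X × X),
    (∀ i, IsOpen (U i)) ∧ (⋃ i, U i) = univ ∧
    ∀ i, ∃ s : C(U i, C(unitInterval, X)),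
      ∀ u : U i, (s u 0, s u 1) = (u : X × X)


/-- The unit circle `S^1 ⊂ ℂ`. -/
abbrev S1 : Type := (Metric.sphere (0 : ℂ) 1 : Set ℂ)

/-- The involution of the `n`-torus sending `(z_1, …, z_{n-1}, z_n)` to
`(z̄_1, …, z̄_{n-1}, −z_n)`. -/
noncomputable def kleinInv (n : ℕ) (z : Fin n → S1) : Fin n → S1 := fun i =>
  if (i : ℕ) < n - 1 then
    ⟨starRingEnd ℂ (z i : ℂ), by
      have : ‖(z i : ℂ)‖ = 1 := mem_sphere_zero_iff_norm.mp (z i).2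
      simpa [mem_sphere_zero_iff_norm] using this⟩
  else
    ⟨-(z i : ℂ), by
      have : ‖(z i : ℂ)‖ = 1 := mem_sphere_zero_iff_norm.mp (z i).2
      simpa [mem_sphere_zero_iff_norm] using this⟩

/-- The `n`-dimensional Klein bottle: the quotient of the `n`-torus `(S^1)^n` by the
identification `(z_1, …, z_{n-1}, z_n) ∼ (z̄_1, …, z̄_{n-1}, −z_n)`. -/
def Klein (n : ℕ) : Type :=
  Quot (fun z w : Fin n → S1 => w = kleinInv n z)

noncomputable instance (n : ℕ) : TopologicalSpace (Klein n) := by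
  unfold Klein; infer_instance

abbrev Heis : Type := ZMod 2 × ZMod 2 × ZMod 2

def mulLeftA (x : Heis) : Heis := (x.1 + 1, x.2.1, x.2.2 + x.2.1)
def mulLeftB (x : Heis) : Heis := (x.1, x.2.1 + 1, x.2.2)
def mulRightA (x : Heis) : Heis := (x.1 + 1, x.2.1, x.2.2)
def mulRightB (x : Heis) : Heis := (x.1, x.2.1 + 1, x.2.2 + x.1)

def det3 (x y z : Heis) : ZMod 2 :=
  x.1 * (y.2.1 * z.2.2 - y.2.2 * z.2.1) - x.2.1 * (y.1 * z.2.2 - y.2.2 * z.1)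
    + x.2.2 * (y.1 * z.2.1 - y.2.1 * z.1)

def cocycle (x₀ x₁ x₂ x₃ x₄ : Fin 4 → Heis) : ZMod 2 :=
  ((x₁ 0).1 - (x₀ 0).1) * det3 (x₂ 1 - x₁ 1) (x₃ 2 - x₂ 2) (x₄ 3 - x₃ 3)

lemma cocycle_closed (x₀ x₁ x₂ x₃ x₄ x₅ : Fin 4 → Heis) :
    cocycle x₁ x₂ x₃ x₄ x₅ + cocycle x₀ x₂ x₃ x₄ x₅ + cocycle x₀ x₁ x₃ x₄ x₅
      + cocycle x₀ x₁ x₂ x₄ x₅ + cocycle x₀ x₁ x₂ x₃ x₅ + cocycle x₀ x₁ x₂ x₃ x₄ = 0 := by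
  have h : cocycle x₁ x₂ x₃ x₄ x₅ - cocycle x₀ x₂ x₃ x₄ x₅ + cocycle x₀ x₁ x₃ x₄ x₅
      - cocycle x₀ x₁ x₂ x₄ x₅ + cocycle x₀ x₁ x₂ x₃ x₅ - cocycle x₀ x₁ x₂ x₃ x₄ = 0 := by
    simp only [cocycle, det3, Prod.fst_sub, Prod.snd_sub]
    ring
  simpa only [CharTwo.sub_eq_add] using h

lemma cocycle_mulLeftA (x₀ x₁ x₂ x₃ x₄ : Fin 4 → Heis) :
    cocycle (mulLeftA ∘ x₀) (mulLeftA ∘ x₁) (mulLeftA ∘ x₂) (mulLeftA ∘ x₃) (mulLeftA ∘ x₄)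
      = cocycle x₀ x₁ x₂ x₃ x₄ := by
  simp only [cocycle, det3, mulLeftA, Function.comp_apply, Prod.fst_sub, Prod.snd_sub]
  ring

lemma cocycle_mulLeftB (x₀ x₁ x₂ x₃ x₄ : Fin 4 → Heis) :
    cocycle (mulLeftB ∘ x₀) (mulLeftB ∘ x₁) (mulLeftB ∘ x₂) (mulLeftB ∘ x₃) (mulLeftB ∘ x₄)
      = cocycle x₀ x₁ x₂ x₃ x₄ := by
  simp only [cocycle, det3, mulLeftB, Function.comp_apply, Prod.fst_sub, Prod.snd_sub]
  ring

lemma cocycle_mulRightA (x₀ x₁ x₂ x₃ x₄ : Fin 4 → Heis) :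
    cocycle (mulRightA ∘ x₀) (mulRightA ∘ x₁) (mulRightA ∘ x₂) (mulRightA ∘ x₃)
      (mulRightA ∘ x₄) = cocycle x₀ x₁ x₂ x₃ x₄ := by
  simp only [cocycle, det3, mulRightA, Function.comp_apply, Prod.fst_sub, Prod.snd_sub]
  ring

lemma cocycle_mulRightB (x₀ x₁ x₂ x₃ x₄ : Fin 4 → Heis) :
    cocycle (mulRightB ∘ x₀) (mulRightB ∘ x₁) (mulRightB ∘ x₂) (mulRightB ∘ x₃)
      (mulRightB ∘ x₄) = cocycle x₀ x₁ x₂ x₃ x₄ := by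
  simp only [cocycle, det3, mulRightB, Function.comp_apply, Prod.fst_sub, Prod.snd_sub]
  ring

def prism (x₀ x₁ x₂ x₃ y₀ y₁ y₂ y₃ : Fin 4 → Heis) : ZMod 2 :=
  cocycle x₀ y₀ y₁ y₂ y₃ + cocycle x₀ x₁ y₁ y₂ y₃ + cocycle x₀ x₁ x₂ y₂ y₃
    + cocycle x₀ x₁ x₂ x₃ y₃

lemma cocycle_add_cocycle (x₀ x₁ x₂ x₃ x₄ y₀ y₁ y₂ y₃ y₄ : Fin 4 → Heis) :
    cocycle x₀ x₁ x₂ x₃ x₄ + cocycle y₀ y₁ y₂ y₃ y₄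
      = prism x₁ x₂ x₃ x₄ y₁ y₂ y₃ y₄ + prism x₀ x₂ x₃ x₄ y₀ y₂ y₃ y₄
        + prism x₀ x₁ x₃ x₄ y₀ y₁ y₃ y₄ + prism x₀ x₁ x₂ x₄ y₀ y₁ y₂ y₄
        + prism x₀ x₁ x₂ x₃ y₀ y₁ y₂ y₃ := by
  have e₀ := cocycle_closed x₀ y₀ y₁ y₂ y₃ y₄
  have e₁ := cocycle_closed x₀ x₁ y₁ y₂ y₃ y₄
  have e₂ := cocycle_closed x₀ x₁ x₂ y₂ y₃ y₄
  have e₃ := cocycle_closed x₀ x₁ x₂ x₃ y₃ y₄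
  have e₄ := cocycle_closed x₀ x₁ x₂ x₃ x₄ y₄
  have h2 : (2 : ZMod 2) = 0 := rfl
  simp only [prism]
  linear_combination e₀ + e₁ + e₂ + e₃ + e₄ - (
    cocycle x₀ y₁ y₂ y₃ y₄ + cocycle x₀ x₁ y₂ y₃ y₄ + cocycle x₀ x₁ x₂ y₃ y₄ + cocycle x₀ x₁ x₂ x₃ y₄
    + cocycle x₁ y₁ y₂ y₃ y₄ + cocycle x₁ x₂ y₂ y₃ y₄ + cocycle x₁ x₂ x₃ y₃ y₄ + cocycle x₁ x₂ x₃ x₄ y₄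
    + cocycle x₀ y₀ y₂ y₃ y₄ + cocycle x₀ x₂ y₂ y₃ y₄ + cocycle x₀ x₂ x₃ y₃ y₄ + cocycle x₀ x₂ x₃ x₄ y₄
    + cocycle x₀ y₀ y₁ y₃ y₄ + cocycle x₀ x₁ y₁ y₃ y₄ + cocycle x₀ x₁ x₃ y₃ y₄ + cocycle x₀ x₁ x₃ x₄ y₄
    + cocycle x₀ y₀ y₁ y₂ y₄ + cocycle x₀ x₁ y₁ y₂ y₄ + cocycle x₀ x₁ x₂ y₂ y₄ + cocycle x₀ x₁ x₂ x₄ y₄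
    + cocycle x₀ y₀ y₁ y₂ y₃ + cocycle x₀ x₁ y₁ y₂ y₃ + cocycle x₀ x₁ x₂ y₂ y₃ + cocycle x₀ x₁ x₂ x₃ y₃) * h2

abbrev Vertex : Type := ℕ × ℕ × ℕ × ℕ

def step₁ (p : Vertex) : Vertex := (p.1 + 1, p.2.1, p.2.2.1, p.2.2.2)
def step₂ (p : Vertex) : Vertex := (p.1, p.2.1 + 1, p.2.2.1, p.2.2.2)
def step₃ (p : Vertex) : Vertex := (p.1, p.2.1, p.2.2.1 + 1, p.2.2.2)
def step₄ (p : Vertex) : Vertex := (p.1, p.2.1, p.2.2.1, p.2.2.2 + 1)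

def orders₃ (H : Vertex → Vertex → Vertex → Vertex → ZMod 2) (f g h : Vertex → Vertex)
    (p : Vertex) : ZMod 2 :=
  H p (f p) (g (f p)) (h (g (f p))) + H p (f p) (h (f p)) (g (h (f p)))
    + H p (g p) (f (g p)) (h (f (g p))) + H p (g p) (h (g p)) (f (h (g p)))
    + H p (h p) (f (h p)) (g (f (h p))) + H p (h p) (g (h p)) (f (g (h p)))

def orders₄ (F : Vertex → Vertex → Vertex → Vertex → Vertex → ZMod 2) (p : Vertex) : ZMod 2 :=
  orders₃ (F p) step₂ step₃ step₄ (step₁ p) + orders₃ (F p) step₁ step₃ step₄ (step₂ p)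
    + orders₃ (F p) step₁ step₂ step₄ (step₃ p) + orders₃ (F p) step₁ step₂ step₃ (step₄ p)

lemma orders₄_coboundary (H : Vertex → Vertex → Vertex → Vertex → ZMod 2) (p : Vertex) :
    orders₄ (fun a b c d e ↦ H b c d e + H a c d e + H a b d e + H a b c e + H a b c d) p
      = (orders₃ H step₂ step₃ step₄ p + orders₃ H step₂ step₃ step₄ (step₁ p)
        + orders₃ H step₁ step₃ step₄ p + orders₃ H step₁ step₃ step₄ (step₂ p))
        + (orders₃ H step₁ step₂ step₄ p + orders₃ H step₁ step₂ step₄ (step₃ p)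
        + orders₃ H step₁ step₂ step₃ p + orders₃ H step₁ step₂ step₃ (step₄ p)) := by
  simp only [orders₄, orders₃, step₁, step₂, step₃, step₄]
  ring_nf
  reduce_mod_char

lemma sum_box_eq_zero (N : ℕ) (E₁ E₂ : ℕ → ℕ → ZMod 2)
    (h₁ : ∀ v, E₁ N v = E₂ v 0) (h₂ : ∀ u, E₂ u N = E₁ 0 u) :
    ∑ u ∈ Finset.range N, ∑ v ∈ Finset.range N,
      (E₁ u v + E₁ (u + 1) v + E₂ u v + E₂ u (v + 1)) = 0 := by
  have t (f : ℕ → ZMod 2) : ∑ u ∈ Finset.range N, (f u + f (u + 1)) = f 0 + f N := by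
    have := Finset.sum_range_sub f N
    simp only [CharTwo.sub_eq_add] at this
    rw [add_comm, ← this]
    exact Finset.sum_congr rfl fun _ _ ↦ add_comm _ _
  have e : ∑ u ∈ Finset.range N, ∑ v ∈ Finset.range N,
      (E₁ u v + E₁ (u + 1) v + E₂ u v + E₂ u (v + 1))
      = ∑ v ∈ Finset.range N, (E₁ 0 v + E₁ N v) + ∑ u ∈ Finset.range N, (E₂ u 0 + E₂ u N) := by
    rw [← Finset.sum_congr rfl fun v _ ↦ t fun u ↦ E₁ u v,
      ← Finset.sum_congr rfl fun u _ ↦ t (E₂ u), Finset.sum_comm (f := fun v u ↦ E₁ u v + _)]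
    simp only [← Finset.sum_add_distrib, add_assoc]
  rw [e, ← Finset.sum_add_distrib]
  refine Finset.sum_eq_zero fun u _ ↦ ?_
  rw [h₁, h₂, add_comm (E₂ u 0), CharTwo.add_self_eq_zero]

/-- Labellings of the lattice that are equivariant for both Klein bottle group actions. -/
structure IsEquivariant (N : ℕ) (L : Vertex → Fin 4 → Heis) : Prop where
  leftA : ∀ u v s t, L (v + N, u, s, t) = mulLeftA ∘ L (u, v, s, t)
  leftB : ∀ u v s t, L (v, u + N, s, t) = mulLeftB ∘ L (u, v, s, t)
  rightA : ∀ u v s t, L (u, v, t + N, s) = mulRightA ∘ L (u, v, s, t)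
  rightB : ∀ u v s t, L (u, v, t, s + N) = mulRightB ∘ L (u, v, s, t)

def boxSum (N : ℕ) (L : Vertex → Fin 4 → Heis) : ZMod 2 :=
  ∑ u ∈ Finset.range N, ∑ v ∈ Finset.range N, ∑ s ∈ Finset.range N, ∑ t ∈ Finset.range N,
    orders₄ (fun a b c d e ↦ cocycle (L a) (L b) (L c) (L d) (L e)) (u, v, s, t)

lemma orders₄_add (F F' : Vertex → Vertex → Vertex → Vertex → Vertex → ZMod 2) (p : Vertex) :
    orders₄ F p + orders₄ F' p = orders₄ (fun a b c d e ↦ F a b c d e + F' a b c d e) p := by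
  simp only [orders₄, orders₃]
  ring

lemma prism_invariant {m : Heis → Heis}
    (hm : ∀ x₀ x₁ x₂ x₃ x₄ : Fin 4 → Heis,
      cocycle (m ∘ x₀) (m ∘ x₁) (m ∘ x₂) (m ∘ x₃) (m ∘ x₄) = cocycle x₀ x₁ x₂ x₃ x₄)
    (x₀ x₁ x₂ x₃ y₀ y₁ y₂ y₃ : Fin 4 → Heis) :
    prism (m ∘ x₀) (m ∘ x₁) (m ∘ x₂) (m ∘ x₃) (m ∘ y₀) (m ∘ y₁) (m ∘ y₂) (m ∘ y₃)
      = prism x₀ x₁ x₂ x₃ y₀ y₁ y₂ y₃ := by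
  simp only [prism, hm]

lemma sum_box₄_eq_zero (N : ℕ) (E₁ E₂ E₃ E₄ : ℕ → ℕ → ℕ → ℕ → ZMod 2)
    (h₁ : ∀ v s t, E₁ N v s t = E₂ v 0 s t) (h₂ : ∀ u s t, E₂ u N s t = E₁ 0 u s t)
    (h₃ : ∀ u v t, E₃ u v N t = E₄ u v t 0) (h₄ : ∀ u v s, E₄ u v s N = E₃ u v 0 s) :
    ∑ u ∈ Finset.range N, ∑ v ∈ Finset.range N, ∑ s ∈ Finset.range N, ∑ t ∈ Finset.range N,
      ((E₁ u v s t + E₁ (u + 1) v s t + E₂ u v s t + E₂ u (v + 1) s t)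
        + (E₃ u v s t + E₃ u v (s + 1) t + E₄ u v s t + E₄ u v s (t + 1))) = 0 := by
  have e₁ : ∑ u ∈ Finset.range N, ∑ v ∈ Finset.range N, ∑ s ∈ Finset.range N,
      ∑ t ∈ Finset.range N,
      (E₁ u v s t + E₁ (u + 1) v s t + E₂ u v s t + E₂ u (v + 1) s t) = 0 := by
    convert sum_box_eq_zero N
      (fun u v ↦ ∑ s ∈ Finset.range N, ∑ t ∈ Finset.range N, E₁ u v s t)
      (fun u v ↦ ∑ s ∈ Finset.range N, ∑ t ∈ Finset.range N, E₂ u v s t)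
      (by simp [h₁]) (by simp [h₂])
    simp only [Finset.sum_add_distrib]
  have e₂ : ∑ u ∈ Finset.range N, ∑ v ∈ Finset.range N, ∑ s ∈ Finset.range N,
      ∑ t ∈ Finset.range N,
      (E₃ u v s t + E₃ u v (s + 1) t + E₄ u v s t + E₄ u v s (t + 1)) = 0 :=
    Finset.sum_eq_zero fun u _ ↦ Finset.sum_eq_zero fun v _ ↦
      sum_box_eq_zero N (E₃ u v) (E₄ u v) (h₃ u v) (h₄ u v)
  rw [← add_zero (0 : ZMod 2)]
  nth_rewrite 1 [← e₁]
  nth_rewrite 1 [← e₂]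
  simp only [← Finset.sum_add_distrib]

lemma boxSum_eq_boxSum {N : ℕ} {L M : Vertex → Fin 4 → Heis} (hL : IsEquivariant N L)
    (hM : IsEquivariant N M) : boxSum N L = boxSum N M := by
  rw [← CharTwo.add_eq_zero]
  set H : Vertex → Vertex → Vertex → Vertex → ZMod 2 :=
    fun a b c d ↦ prism (L a) (L b) (L c) (L d) (M a) (M b) (M c) (M d) with hH
  have key (p : Vertex) : orders₄ (fun a b c d e ↦ cocycle (L a) (L b) (L c) (L d) (L e)) p
      + orders₄ (fun a b c d e ↦ cocycle (M a) (M b) (M c) (M d) (M e)) p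
      = orders₄ (fun a b c d e ↦ H b c d e + H a c d e + H a b d e + H a b c e + H a b c d) p := by
    rw [orders₄_add]
    simp only [cocycle_add_cocycle, hH]
  simp only [boxSum, ← Finset.sum_add_distrib, key, orders₄_coboundary]
  have a (u s t) : L (N, u, s, t) = mulLeftA ∘ L (u, 0, s, t) := by simpa using hL.leftA u 0 s t
  have a' (u s t) : M (N, u, s, t) = mulLeftA ∘ M (u, 0, s, t) := by simpa using hM.leftA u 0 s t
  have b (u s t) : L (u, N, s, t) = mulLeftB ∘ L (0, u, s, t) := by simpa using hL.leftB 0 u s t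
  have b' (u s t) : M (u, N, s, t) = mulLeftB ∘ M (0, u, s, t) := by simpa using hM.leftB 0 u s t
  have c (u v t) : L (u, v, N, t) = mulRightA ∘ L (u, v, t, 0) := by simpa using hL.rightA u v t 0
  have c' (u v t) : M (u, v, N, t) = mulRightA ∘ M (u, v, t, 0) := by
    simpa using hM.rightA u v t 0
  have d (u v s) : L (u, v, s, N) = mulRightB ∘ L (u, v, 0, s) := by simpa using hL.rightB u v 0 s
  have d' (u v s) : M (u, v, s, N) = mulRightB ∘ M (u, v, 0, s) := by
    simpa using hM.rightB u v 0 s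
  refine sum_box₄_eq_zero N (fun u v s t ↦ orders₃ H step₂ step₃ step₄ (u, v, s, t))
    (fun u v s t ↦ orders₃ H step₁ step₃ step₄ (u, v, s, t))
    (fun u v s t ↦ orders₃ H step₁ step₂ step₄ (u, v, s, t))
    (fun u v s t ↦ orders₃ H step₁ step₂ step₃ (u, v, s, t)) ?_ ?_ ?_ ?_ <;> intro x y z
  · simp only [orders₃, step₁, step₂, step₃, step₄, hH, a, a', prism_invariant cocycle_mulLeftA]
  · simp only [orders₃, step₁, step₂, step₃, step₄, hH, b, b', prism_invariant cocycle_mulLeftB]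
  · simp only [orders₃, step₁, step₂, step₃, step₄, hH, c, c', prism_invariant cocycle_mulRightA]
  · simp only [orders₃, step₁, step₂, step₃, step₄, hH, d, d', prism_invariant cocycle_mulRightB]

def cellLabel (d : ZMod 8) : Heis :=
  match d with
  | 0 => (0, 0, 0)
  | 1 => (1, 0, 0)
  | 2 => (1, 1, 1)
  | 3 => (0, 1, 1)
  | 4 => (0, 0, 1)
  | 5 => (1, 0, 1)
  | 6 => (1, 1, 0)
  | 7 => (0, 1, 0)

/-- The quotient of two cell labels in the group of unipotent matrices over the two-element
field. -/
def cellQuotient (d e : ZMod 8) : Heis :=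
  ((cellLabel d).1 + (cellLabel e).1, (cellLabel d).2.1 + (cellLabel e).2.1,
    (cellLabel d).2.2 + (cellLabel e).2.2 + (cellLabel e).1 * (cellLabel e).2.1
      + (cellLabel d).1 * (cellLabel e).2.1)

lemma cellQuotient_leftA (d e : ZMod 8) :
    cellQuotient (1 - d) e = mulLeftA (cellQuotient d e) := by
  revert d e; decide
lemma cellQuotient_leftB (d e : ZMod 8) :
    cellQuotient (-1 - d) e = mulLeftB (cellQuotient d e) := by
  revert d e; decide
lemma cellQuotient_rightA (d e : ZMod 8) :
    cellQuotient d (1 - e) = mulRightA (cellQuotient d e) := by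
  revert d e; decide
lemma cellQuotient_rightB (d e : ZMod 8) :
    cellQuotient d (-1 - e) = mulRightB (cellQuotient d e) := by
  revert d e; decide

def gridLabel (N : ℕ) (p : Vertex) : Heis :=
  cellQuotient (((p.1 / N : ℕ) : ZMod 8) - ((p.2.1 / N : ℕ) : ZMod 8))
    (((p.2.2.1 / N : ℕ) : ZMod 8) - ((p.2.2.2 / N : ℕ) : ZMod 8))

lemma isEquivariant_gridLabel {N : ℕ} (hN : 0 < N) :
    IsEquivariant N fun p _ ↦ gridLabel N p where
  leftA u v s t := by
    funext i
    simp only [gridLabel, Nat.add_div_right _ hN, Function.comp_apply, ← cellQuotient_leftA]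
    push_cast
    ring_nf
  leftB u v s t := by
    funext i
    simp only [gridLabel, Nat.add_div_right _ hN, Function.comp_apply, ← cellQuotient_leftB]
    push_cast
    ring_nf
  rightA u v s t := by
    funext i
    simp only [gridLabel, Nat.add_div_right _ hN, Function.comp_apply, ← cellQuotient_rightA]
    push_cast
    ring_nf
  rightB u v s t := by
    funext i
    simp only [gridLabel, Nat.add_div_right _ hN, Function.comp_apply, ← cellQuotient_rightB]
    push_cast
    ring_nf

lemma orders₄_eq_zero_of_const {L : Vertex → Fin 4 → Heis} {p : Vertex} {i : Fin 4}
    (h : ∀ a b c d : Fin 2, L (p.1 + a, p.2.1 + b, p.2.2.1 + c, p.2.2.2 + d) i = L p i) :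
    orders₄ (fun a b c d e ↦ cocycle (L a) (L b) (L c) (L d) (L e)) p = 0 := by
  simp only [Fin.forall_fin_two, Fin.val_zero, Fin.val_one, add_zero] at h
  obtain ⟨⟨⟨⟨-, h1⟩, h2, h3⟩, ⟨h4, h5⟩, h6, h7⟩, ⟨⟨h8, h9⟩, h10, h11⟩, ⟨h12, h13⟩, h14, h15⟩ := h
  fin_cases i <;> simp only [Fin.zero_eta, Fin.mk_one, Fin.reduceFinMk] at * <;>
    simp only [orders₄, orders₃, cocycle, det3, step₁, step₂, step₃, step₄, h1, h2, h3, h4, h5, h6,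
      h7, h8, h9, h10, h11, h12, h13, h14, h15, sub_self, Prod.fst_zero, Prod.snd_zero,
      zero_mul, mul_zero, add_zero]

def cornerLabel (α β γ δ : Fin 2) (p : Vertex) : Heis :=
  cellQuotient (((p.1 * α : ℕ) : ZMod 8) - ((p.2.1 * β : ℕ) : ZMod 8))
    (((p.2.2.1 * γ : ℕ) : ZMod 8) - ((p.2.2.2 * δ : ℕ) : ZMod 8))

lemma orders₄_cornerLabel (α β γ δ : Fin 2) :
    orders₄ (fun a b c d e ↦ cocycle (fun _ ↦ cornerLabel α β γ δ a)
      (fun _ ↦ cornerLabel α β γ δ b) (fun _ ↦ cornerLabel α β γ δ c)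
      (fun _ ↦ cornerLabel α β γ δ d) (fun _ ↦ cornerLabel α β γ δ e)) (0, 0, 0, 0)
      = if α = 1 ∧ β = 1 ∧ γ = 1 ∧ δ = 1 then 1 else 0 := by
  revert α β γ δ; decide +kernel

lemma boxSum_gridLabel {N : ℕ} (hN : 0 < N) : boxSum N (fun p _ ↦ gridLabel N p) = 1 := by
  have h0 {u : ℕ} (hu : u < N) : u / N = 0 := Nat.div_eq_of_lt hu
  have h1 {u : ℕ} (hu : u < N) : (u + 1) / N = ((if u = N - 1 then 1 else 0 : Fin 2) : ℕ) := by
    split_ifs with h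
    · rw [h, Nat.sub_add_cancel hN, Nat.div_self hN]; rfl
    · exact Nat.div_eq_of_lt (by omega)
  have key (u v s t : ℕ) (hu : u < N) (hv : v < N) (hs : s < N) (ht : t < N) :
      orders₄ (fun a b c d e ↦ cocycle (fun _ ↦ gridLabel N a) (fun _ ↦ gridLabel N b)
        (fun _ ↦ gridLabel N c) (fun _ ↦ gridLabel N d) (fun _ ↦ gridLabel N e)) (u, v, s, t)
        = if u = N - 1 then if v = N - 1 then if s = N - 1 then if t = N - 1 then 1 else 0
          else 0 else 0 else 0 := by
    refine Eq.trans ?_ ((orders₄_cornerLabel (if u = N - 1 then 1 else 0)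
      (if v = N - 1 then 1 else 0) (if s = N - 1 then 1 else 0)
      (if t = N - 1 then 1 else 0)).trans ?_)
    · simp only [orders₄, orders₃, step₁, step₂, step₃, step₄, gridLabel, cornerLabel, h0 hu, h0 hv,
        h0 hs, h0 ht, h1 hu, h1 hv, h1 hs, h1 ht, zero_mul, zero_add, one_mul]
    · have e (P : Prop) [Decidable P] : (if P then (1 : Fin 2) else 0) = 1 ↔ P := by
        split_ifs with h <;> simp [h]
      simp only [e, ite_and]
  trans ∑ u ∈ Finset.range N, ∑ v ∈ Finset.range N, ∑ s ∈ Finset.range N, ∑ t ∈ Finset.range N,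
    if u = N - 1 then if v = N - 1 then if s = N - 1 then if t = N - 1 then (1 : ZMod 2) else 0
      else 0 else 0 else 0
  · exact Finset.sum_congr rfl fun u hu ↦ Finset.sum_congr rfl fun v hv ↦
      Finset.sum_congr rfl fun s hs ↦ Finset.sum_congr rfl fun t ht ↦ key u v s t
        (Finset.mem_range.1 hu) (Finset.mem_range.1 hv) (Finset.mem_range.1 hs)
        (Finset.mem_range.1 ht)
  · simp [Finset.sum_ite_eq', hN]

/-- No four equivariant labellings can cover the lattice by cubes of constant label. -/
theorem exists_cube_not_const {N : ℕ} (hN : 0 < N) {L : Vertex → Fin 4 → Heis}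
    (hL : IsEquivariant N L) :
    ∃ u < N, ∃ v < N, ∃ s < N, ∃ t < N, ∀ i, ∃ a b c d : Fin 2,
      L (u + a, v + b, s + c, t + d) i ≠ L (u, v, s, t) i := by
  by_contra! h
  have h0 : boxSum N L = 0 := by
    refine Finset.sum_eq_zero fun u hu ↦ Finset.sum_eq_zero fun v hv ↦ Finset.sum_eq_zero
      fun s hs ↦ Finset.sum_eq_zero fun t ht ↦ ?_
    rw [Finset.mem_range] at hu hv hs ht
    obtain ⟨i, hi⟩ := h u hu v hv s hs t ht
    exact orders₄_eq_zero_of_const hi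
  have h1 := boxSum_gridLabel hN
  rw [← boxSum_eq_boxSum hL (isEquivariant_gridLabel hN), h0] at h1
  exact zero_ne_one h1

/-- The group of deck transformations of the plane over the Klein bottle; it acts simply
transitively on the unit squares of the integer lattice. -/
@[ext] structure DeckGroup where
  m : ℤ
  n : ℤ

namespace DeckGroup

instance : Mul DeckGroup where
  mul g h := if Even (g.m + g.n) then ⟨g.m + h.m, g.n + h.n⟩ else ⟨g.m + h.n, g.n + h.m⟩

instance : One DeckGroup := ⟨⟨0, 0⟩⟩

instance : Inv DeckGroup where
  inv g := if Even (g.m + g.n) then ⟨-g.m, -g.n⟩ else ⟨-g.n, -g.m⟩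

lemma mul_def (g h : DeckGroup) :
    g * h = if Even (g.m + g.n) then ⟨g.m + h.m, g.n + h.n⟩ else ⟨g.m + h.n, g.n + h.m⟩ := rfl

lemma one_def : (1 : DeckGroup) = ⟨0, 0⟩ := rfl

lemma inv_def (g : DeckGroup) :
    g⁻¹ = if Even (g.m + g.n) then ⟨-g.m, -g.n⟩ else ⟨-g.n, -g.m⟩ := rfl

lemma mk_mul_mk_of_even {m n : ℤ} (h : Even (m + n)) (g : DeckGroup) :
    (⟨m, n⟩ : DeckGroup) * g = ⟨m + g.m, n + g.n⟩ := if_pos h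

lemma mk_mul_mk_of_odd {m n : ℤ} (h : ¬ Even (m + n)) (g : DeckGroup) :
    (⟨m, n⟩ : DeckGroup) * g = ⟨m + g.n, n + g.m⟩ := if_neg h

lemma even_mul (g h : DeckGroup) :
    Even ((g * h).m + (g * h).n) ↔ (Even (g.m + g.n) ↔ Even (h.m + h.n)) := by
  rw [mul_def, ← Int.even_add]
  split_ifs <;> simp only <;> ring_nf

instance : Group DeckGroup := Group.ofLeftAxioms
  (fun g h k ↦ by
    have e := even_mul g h
    rw [mul_def (g * h), mul_def g (h * k)]
    by_cases h1 : Even (g.m + g.n) <;> by_cases h2 : Even (h.m + h.n) <;>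
      simp only [h1, h2, iff_true, iff_false, not_true_eq_false] at e <;>
      simp only [e, if_true, if_false] <;>
      simp only [h1, h2, mul_def, if_true, if_false, add_assoc])
  (fun g ↦ by simp [mul_def, one_def])
  (fun g ↦ by
    rw [inv_def, one_def]
    split_ifs with h
    · rw [mk_mul_mk_of_even (by rwa [← neg_add, even_neg])]; simp
    · rw [mk_mul_mk_of_odd (by rwa [← neg_add, even_neg, add_comm])]; simp)

noncomputable instance : SMul DeckGroup (ℝ × ℝ) where
  smul g P := if Even (g.m + g.n) then (P.1 + g.m, P.2 + g.n) else (P.2 + g.m, P.1 + g.n)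

lemma smul_def (g : DeckGroup) (P : ℝ × ℝ) :
    g • P = if Even (g.m + g.n) then (P.1 + g.m, P.2 + g.n) else (P.2 + g.m, P.1 + g.n) := rfl

noncomputable instance : MulAction DeckGroup (ℝ × ℝ) where
  one_smul P := by simp [smul_def, one_def]
  mul_smul g h P := by
    have e := even_mul g h
    rw [smul_def (g * h), smul_def g]
    by_cases h1 : Even (g.m + g.n) <;> by_cases h2 : Even (h.m + h.n) <;>
      simp only [h1, h2, iff_true, iff_false, not_true_eq_false] at e <;>
      simp only [e, if_true, if_false] <;>
      simp only [h1, h2, mul_def, smul_def, if_true, if_false, Int.cast_add, add_assoc] <;>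
      simp only [add_comm]

instance : ContinuousConstSMul DeckGroup (ℝ × ℝ) where
  continuous_const_smul g := by
    simp only [smul_def]
    split_ifs <;> fun_prop

end DeckGroup

/-- The point of the unit circle with argument `π x`. -/
noncomputable def circlePoint (x : ℝ) : S1 :=
  ⟨Complex.exp ((Real.pi * x : ℝ) * Complex.I), by
    rw [mem_sphere_zero_iff_norm, Complex.norm_exp_ofReal_mul_I]⟩

lemma continuous_circlePoint : Continuous circlePoint := by
  unfold circlePoint
  fun_prop

lemma circlePoint_eq_iff {x y : ℝ} : circlePoint x = circlePoint y ↔ ∃ k : ℤ, x = y + 2 * k := by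
  rw [circlePoint, circlePoint, Subtype.mk_eq_mk, Complex.exp_eq_exp_iff_exists_int]
  refine exists_congr fun k ↦ ?_
  rw [show ((Real.pi * y : ℝ) : ℂ) * Complex.I + k * (2 * Real.pi * Complex.I)
    = ((Real.pi * (y + 2 * k) : ℝ) : ℂ) * Complex.I by push_cast; ring,
    mul_left_inj' Complex.I_ne_zero, Complex.ofReal_inj, mul_right_inj' Real.pi_ne_zero]

lemma exists_circlePoint (z : S1) : ∃ x, |x| ≤ 1 ∧ circlePoint x = z := by
  refine ⟨Complex.arg z / Real.pi, ?_, Subtype.ext ?_⟩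
  · rw [abs_div, abs_of_pos Real.pi_pos, div_le_one Real.pi_pos]
    exact Complex.abs_arg_le_pi _
  have h : ‖(z : ℂ)‖ = 1 := mem_sphere_zero_iff_norm.mp z.2
  have := Complex.norm_mul_exp_arg_mul_I (z : ℂ)
  rw [h, Complex.ofReal_one, one_mul] at this
  simpa only [circlePoint, mul_div_cancel₀ _ Real.pi_ne_zero] using this

noncomputable def torusMap (P : ℝ × ℝ) : Fin 2 → S1 :=
  ![circlePoint (P.1 - P.2 - 1 / 2), circlePoint (P.1 + P.2)]

lemma continuous_torusMap : Continuous torusMap := by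
  refine continuous_pi fun i ↦ ?_
  fin_cases i
  · exact continuous_circlePoint.comp (by fun_prop)
  · exact continuous_circlePoint.comp (by fun_prop)

lemma kleinInv_torusMap (P : ℝ × ℝ) :
    kleinInv 2 (torusMap P) = torusMap (P.2 + 1, P.1) := by
  funext i
  fin_cases i
  · refine Subtype.ext ?_
    change starRingEnd ℂ (Complex.exp _) = Complex.exp _
    rw [← Complex.exp_conj, map_mul, Complex.conj_ofReal, Complex.conj_I, mul_neg, ← neg_mul,
      ← Complex.ofReal_neg]
    ring_nf
  · refine Subtype.ext ?_
    simp [kleinInv, torusMap, circlePoint]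
    rw [show (Real.pi * (P.2 + 1 + P.1) : ℂ) * Complex.I
      = Real.pi * (P.1 + P.2) * Complex.I + Real.pi * Complex.I by ring, Complex.exp_add,
      Complex.exp_pi_mul_I]
    ring

lemma kleinInv_kleinInv (n : ℕ) (z : Fin n → S1) : kleinInv n (kleinInv n z) = z := by
  funext i
  refine Subtype.ext ?_
  by_cases h : (i : ℕ) < n - 1 <;> simp [kleinInv, h]

def Klein.mk (z : Fin 2 → S1) : Klein 2 := Quot.mk _ z

lemma Klein.mk_eq_mk_iff {z w : Fin 2 → S1} : Klein.mk z = Klein.mk w ↔ w = z ∨ w = kleinInv 2 z := by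
  constructor
  · intro h
    replace h := Quot.eqvGen_exact h
    induction h with
    | rel _ _ h => exact .inr h
    | refl => exact .inl rfl
    | symm _ _ _ ih =>
      rcases ih with rfl | rfl
      · exact .inl rfl
      · exact .inr (kleinInv_kleinInv _ _).symm
    | trans _ _ _ _ _ ih ih' =>
      rcases ih with rfl | rfl <;> rcases ih' with rfl | rfl <;> simp [kleinInv_kleinInv]
  · rintro (rfl | rfl)
    · rfl
    · exact Quot.sound rfl

lemma exists_torusMap (z : Fin 2 → S1) :
    ∃ P ∈ Icc ((-2, -2) : ℝ × ℝ) (2, 2), torusMap P = z := by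
  obtain ⟨x, hx', hx⟩ := exists_circlePoint (z 0)
  obtain ⟨y, hy', hy⟩ := exists_circlePoint (z 1)
  refine ⟨((y + x + 1 / 2) / 2, (y - x - 1 / 2) / 2), ?_, ?_⟩
  · rw [abs_le] at hx' hy'
    refine ⟨⟨?_, ?_⟩, ⟨?_, ?_⟩⟩ <;> simp only <;> linarith
  funext i
  fin_cases i
  · simp [torusMap, ← hx]; ring_nf
  · simp [torusMap, ← hy]; ring_nf

lemma torusMap_eq_iff {P Q : ℝ × ℝ} : torusMap P = torusMap Q ↔
    ∃ g : DeckGroup, Even (g.m + g.n) ∧ g • Q = P := by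
  have : torusMap P = torusMap Q ↔ circlePoint (P.1 - P.2 - 1 / 2) = circlePoint (Q.1 - Q.2 - 1 / 2)
      ∧ circlePoint (P.1 + P.2) = circlePoint (Q.1 + Q.2) := by
    simp [torusMap, funext_iff, Fin.forall_fin_two]
  rw [this, circlePoint_eq_iff, circlePoint_eq_iff]
  constructor
  · rintro ⟨⟨k, hk⟩, l, hl⟩
    have : Even ((k + l) + (l - k)) := ⟨l, by ring⟩
    refine ⟨⟨k + l, l - k⟩, this, ?_⟩
    rw [DeckGroup.smul_def, if_pos this]
    refine Prod.ext ?_ ?_ <;> push_cast <;> linarith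
  · rintro ⟨⟨m, n⟩, ⟨k, hk⟩, rfl⟩
    rw [DeckGroup.smul_def, if_pos ⟨k, hk⟩]
    simp only at hk ⊢
    obtain rfl : m = 2 * k - n := by omega
    refine ⟨⟨k - n, ?_⟩, k, ?_⟩ <;> push_cast <;> ring

noncomputable def planeMap (P : ℝ × ℝ) : Klein 2 := Klein.mk (torusMap P)

lemma planeMap_eq_iff {P Q : ℝ × ℝ} :
    planeMap P = planeMap Q ↔ P ∈ MulAction.orbit DeckGroup Q := by
  have hab (P : ℝ × ℝ) : (P.2 + 1, P.1) = (⟨1, 0⟩ : DeckGroup) • P := by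
    simp [DeckGroup.smul_def]
  rw [planeMap, planeMap, eq_comm, Klein.mk_eq_mk_iff, kleinInv_torusMap, torusMap_eq_iff,
    torusMap_eq_iff, hab, MulAction.mem_orbit_iff]
  constructor
  · rintro (⟨g, -, rfl⟩ | ⟨g, -, rfl⟩)
    · exact ⟨g, rfl⟩
    · exact ⟨g * ⟨1, 0⟩, mul_smul _ _ _⟩
  · rintro ⟨g, rfl⟩
    by_cases h : Even (g.m + g.n)
    · exact .inl ⟨g, h, rfl⟩
    · refine .inr ⟨g * ⟨1, 0⟩⁻¹, ?_, by rw [mul_smul, inv_smul_smul]⟩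
      rw [DeckGroup.even_mul]
      simp [h, DeckGroup.inv_def]

lemma isQuotientMap_torusMap : Topology.IsQuotientMap torusMap := by
  have hc : Continuous fun P : Icc ((-2, -2) : ℝ × ℝ) (2, 2) ↦ torusMap P :=
    continuous_torusMap.comp continuous_subtype_val
  refine Topology.IsQuotientMap.of_comp continuous_subtype_val continuous_torusMap
    (hc.isClosedMap.isQuotientMap hc fun z ↦ ?_)
  obtain ⟨P, hP, h⟩ := exists_torusMap z
  exact ⟨⟨P, hP⟩, h⟩

lemma isQuotientCoveringMap_planeMap : IsQuotientCoveringMap planeMap DeckGroup where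
  toIsQuotientMap := isQuotientMap_quot_mk.comp isQuotientMap_torusMap
  toContinuousConstSMul := inferInstance
  apply_eq_iff_mem_orbit := planeMap_eq_iff
  disjoint P := by
    refine ⟨Metric.ball P (1 / 4), Metric.ball_mem_nhds _ (by norm_num), ?_⟩
    rintro ⟨m, n⟩ ⟨_, ⟨Q, hQ, rfl⟩, hQ'⟩
    simp only [Metric.mem_ball, Prod.dist_eq, max_lt_iff, Real.dist_eq, abs_lt] at hQ hQ'
    obtain ⟨⟨h1, h2⟩, h3, h4⟩ := hQ
    rw [DeckGroup.smul_def] at hQ'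
    split_ifs at hQ' with h <;> obtain ⟨⟨h5, h6⟩, h7, h8⟩ := hQ' <;>
      simp only at h h5 h6 h7 h8
    · have hm : m < 1 := by exact_mod_cast (by linarith : (m : ℝ) < 1)
      have hm' : -1 < m := by exact_mod_cast (by linarith : (-1 : ℝ) < m)
      have hn : n < 1 := by exact_mod_cast (by linarith : (n : ℝ) < 1)
      have hn' : -1 < n := by exact_mod_cast (by linarith : (-1 : ℝ) < n)
      rw [DeckGroup.one_def, DeckGroup.mk.injEq]
      omega
    · have hm : m + n < 1 := by exact_mod_cast (by linarith : (m + n : ℝ) < 1)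
      have hm' : -1 < m + n := by exact_mod_cast (by linarith : (-1 : ℝ) < m + n)
      exact absurd ⟨0, by omega⟩ h

def openSquare (c : ℝ) : Set (ℝ × ℝ) := Ioo c (c + 1) ×ˢ Ioo c (c + 1)

lemma injOn_planeMap_openSquare (c : ℝ) : InjOn planeMap (openSquare c) := by
  rintro P ⟨⟨h1, h2⟩, h3, h4⟩ Q ⟨⟨h5, h6⟩, h7, h8⟩ h
  obtain ⟨⟨m, n⟩, rfl⟩ := planeMap_eq_iff.1 h
  simp only [DeckGroup.smul_def] at h1 h2 h3 h4 ⊢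
  have hmn : m = 0 ∧ n = 0 := by
    split_ifs at h1 h2 h3 h4 with h <;> simp only at h h1 h2 h3 h4
    all_goals
      have hm : m < 1 := by exact_mod_cast (by linarith : (m : ℝ) < 1)
      have hm' : -1 < m := by exact_mod_cast (by linarith : (-1 : ℝ) < m)
      have hn : n < 1 := by exact_mod_cast (by linarith : (n : ℝ) < 1)
      have hn' : -1 < n := by exact_mod_cast (by linarith : (-1 : ℝ) < n)
      omega
  simp [hmn.1, hmn.2]

lemma exists_mem_openSquare {c : ℝ} {P : ℝ × ℝ} (h₁ : ∀ k : ℤ, P.1 ≠ c + k)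
    (h₂ : ∀ k : ℤ, P.2 ≠ c + k) : planeMap P ∈ planeMap '' openSquare c := by
  have key {x : ℝ} (h : ∀ k : ℤ, x ≠ c + k) : x - ⌊x - c⌋ ∈ Ioo c (c + 1) := by
    have := Int.floor_le (x - c)
    have := Int.lt_floor_add_one (x - c)
    have : c ≠ x - ⌊x - c⌋ := fun e ↦ h ⌊x - c⌋ (by linarith)
    exact ⟨lt_of_le_of_ne (by linarith) this, by linarith⟩
  have k₁ := key h₁
  have k₂ := key h₂
  generalize ⌊P.1 - c⌋ = m at k₁
  generalize ⌊P.2 - c⌋ = n at k₂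
  by_cases h : Even (m + n)
  · refine ⟨(⟨-m, -n⟩ : DeckGroup) • P, ?_, isQuotientCoveringMap_planeMap.map_smul _⟩
    rw [DeckGroup.smul_def, if_pos (by rwa [← neg_add, even_neg])]
    push_cast
    exact ⟨k₁, k₂⟩
  · refine ⟨(⟨-n, -m⟩ : DeckGroup) • P, ?_, isQuotientCoveringMap_planeMap.map_smul _⟩
    rw [DeckGroup.smul_def, if_neg (by rwa [← neg_add, even_neg, add_comm])]
    push_cast
    exact ⟨k₂, k₁⟩

lemma exists_fin_five_avoiding (r : Fin 4 → ℝ) :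
    ∃ i : Fin 5, ∀ j, ∀ k : ℤ, r j ≠ (i : ℕ) / 5 + k := by
  by_contra! h
  choose f k hk using h
  obtain ⟨i, j, hij, hf⟩ := Fintype.exists_ne_map_eq_of_card_lt f (by simp)
  have h := (hk i).symm.trans ((congrArg r hf).trans (hk j))
  have : ((i : ℕ) + 5 * k i : ℤ) = (j : ℕ) + 5 * k j := by
    have : ((i : ℕ) + 5 * k i : ℝ) = (j : ℕ) + 5 * k j := by linarith
    exact_mod_cast this
  exact hij (Fin.ext (by omega))

lemma exists_section_openSquare (c : ℝ) :
    ∃ s : C(((planeMap '' openSquare c) ×ˢ (planeMap '' openSquare c) : Set (Klein 2 × Klein 2)),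
      C(unitInterval, Klein 2)), ∀ u, (s u 0, s u 1) = (u : Klein 2 × Klein 2) := by
  have hq := isQuotientCoveringMap_planeMap
  have hW : IsOpen (openSquare c) := isOpen_Ioo.prod isOpen_Ioo
  have he : Topology.IsOpenEmbedding ((openSquare c).domRestrict planeMap) :=
    .of_continuous_injective_isOpenMap (hq.continuous.comp continuous_subtype_val)
      (injOn_planeMap_openSquare c).injective
      (hq.isCoveringMap.isOpenMap.comp hW.isOpenMap_subtype_val)
  have hr (x : planeMap '' openSquare c) : (x : Klein 2) ∈ range ((openSquare c).domRestrict planeMap) := by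
    rw [range_domRestrict]; exact x.2
  let σ : C(planeMap '' openSquare c, ℝ × ℝ) :=
    ⟨fun x ↦ (he.isEmbedding.toHomeomorph.symm ⟨x, hr x⟩ : openSquare c), by fun_prop⟩
  have hσ x : planeMap (σ x) = x :=
    congrArg Subtype.val (he.isEmbedding.toHomeomorph.apply_symm_apply ⟨x, hr x⟩)
  refine ⟨ContinuousMap.curry ⟨fun p ↦ planeMap ((1 - (p.2 : ℝ)) • σ ⟨p.1.1.1, p.1.2.1⟩
    + (p.2 : ℝ) • σ ⟨p.1.1.2, p.1.2.2⟩), hq.continuous.comp (by fun_prop)⟩, fun u ↦ ?_⟩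
  simp [hσ]

theorem hasMPCover_klein_two_five : HasMPCover (Klein 2) 5 := by
  have hq := isQuotientCoveringMap_planeMap
  have ho (c : ℝ) : IsOpen (planeMap '' openSquare c) :=
    hq.isCoveringMap.isOpenMap _ (isOpen_Ioo.prod isOpen_Ioo)
  refine ⟨fun i ↦ (planeMap '' openSquare ((i : ℕ) / 5)) ×ˢ (planeMap '' openSquare ((i : ℕ) / 5)),
    fun i ↦ (ho _).prod (ho _), eq_univ_of_forall fun ⟨x, y⟩ ↦ ?_,
    fun i ↦ exists_section_openSquare _⟩
  obtain ⟨P, rfl⟩ := hq.surjective x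
  obtain ⟨Q, rfl⟩ := hq.surjective y
  obtain ⟨i, hi⟩ := exists_fin_five_avoiding ![P.1, P.2, Q.1, Q.2]
  exact mem_iUnion.2 ⟨i, exists_mem_openSquare (hi 0) (hi 1), exists_mem_openSquare (hi 2) (hi 3)⟩

lemma exists_deckGroup_label {V : Set (Klein 2 × Klein 2)} (s : C(V, C(unitInterval, Klein 2)))
    (hs : ∀ u : V, (s u 0, s u 1) = (u : Klein 2 × Klein 2)) :
    ∃ g : (ℝ × ℝ) × (ℝ × ℝ) → DeckGroup,
      (∀ P Q, (planeMap P, planeMap Q) ∈ V → ∀ h k : DeckGroup,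
        g (h • P, k • Q) = h * g (P, Q) * k⁻¹) ∧
      ∀ C, IsPreconnected C → (∀ p ∈ C, (planeMap p.1, planeMap p.2) ∈ V) →
        ∀ p ∈ C, ∀ p' ∈ C, g p = g p' := by
  classical
  have hq := isQuotientCoveringMap_planeMap
  have := hq.isCancelSMul
  have hc : Continuous planeMap := hq.continuous
  let A : Set ((ℝ × ℝ) × (ℝ × ℝ)) := {p | (planeMap p.1, planeMap p.2) ∈ V}
  let π : C(A, V) := ⟨fun p ↦ ⟨(planeMap p.1.1, planeMap p.1.2), p.2⟩, by fun_prop⟩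
  let H : C(unitInterval × A, Klein 2) := ⟨fun x ↦ s (π x.2) x.1, by fun_prop⟩
  let f : C(A, ℝ × ℝ) := ⟨fun p ↦ p.1.1, by fun_prop⟩
  have H0 (p : A) : H (0, p) = planeMap (f p) := congrArg Prod.fst (hs (π p))
  have H1 (p : A) : H (1, p) = planeMap p.1.2 := congrArg Prod.snd (hs (π p))
  let E := hq.isCoveringMap.liftHomotopy H f H0
  have hE x : planeMap (E x) = H x := congrFun (hq.isCoveringMap.liftHomotopy_lifts H f H0) x
  have hE0 p : E (0, p) = p.1.1 := hq.isCoveringMap.liftHomotopy_zero H f H0 p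
  have hg (p : A) : ∃ g : DeckGroup, g • p.1.2 = E (1, p) :=
    planeMap_eq_iff.1 ((hE _).trans (H1 p))
  choose g hg using hg
  refine ⟨fun p ↦ if hp : p ∈ A then g ⟨p, hp⟩ else 1, fun P Q hPQ h k ↦ ?_,
    fun C hC hCA p hp p' hp' ↦ ?_⟩
  · have hPQ' : (h • P, k • Q) ∈ A := by
      simpa only [A, mem_ofPred_eq, hq.map_smul] using hPQ
    beta_reduce
    rw [dif_pos hPQ', dif_pos (show (P, Q) ∈ A from hPQ)]
    have hπ : π ⟨(h • P, k • Q), hPQ'⟩ = π ⟨(P, Q), hPQ⟩ :=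
      Subtype.ext (Prod.ext (hq.map_smul h) (hq.map_smul k))
    have key := hq.isCoveringMap.eq_of_comp_eq
      (g₁ := fun t ↦ E (t, ⟨(h • P, k • Q), hPQ'⟩)) (g₂ := fun t ↦ h • E (t, ⟨(P, Q), hPQ⟩))
      (by fun_prop) (by fun_prop)
      (funext fun t ↦ by
        simp only [Function.comp_apply, hq.map_smul, hE]
        exact congrArg (fun v ↦ s v t) hπ) 0 (by simp only [hE0])
    have key := congrFun key 1
    simp only [← hg, ← mul_smul] at key
    rw [eq_mul_inv_iff_mul_eq]
    exact IsCancelSMul.right_cancel _ _ Q key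
  · beta_reduce
    rw [dif_pos (show p ∈ A from hCA p hp), dif_pos (show p' ∈ A from hCA p' hp')]
    have := isPreconnected_iff_preconnectedSpace.1 hC
    have key := hq.isCoveringMap.eq_of_comp_eq
      (g₁ := fun c : C ↦ E (1, ⟨c.1, hCA c.1 c.2⟩)) (g₂ := fun c ↦ g ⟨p, hCA p hp⟩ • c.1.2)
      (by fun_prop) (by fun_prop)
      (funext fun c ↦ by simp only [Function.comp_apply, hq.map_smul, hE, H1]) ⟨p, hp⟩ (hg _).symm
    have key := congrFun key ⟨p', hp'⟩
    simp only [← hg] at key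
    exact (IsCancelSMul.right_cancel _ _ _ key).symm

def deckLabel (g : DeckGroup) : Heis := cellLabel ((g.m - g.n : ℤ) : ZMod 8)

lemma deckLabel_mulLeftA (g : DeckGroup) : deckLabel (⟨1, 0⟩ * g) = mulLeftA (deckLabel g) := by
  have (d : ZMod 8) : cellLabel (1 - d) = mulLeftA (cellLabel d) := by revert d; decide
  rw [DeckGroup.mk_mul_mk_of_odd (by decide), deckLabel, deckLabel, ← this]
  push_cast
  ring_nf

lemma deckLabel_mulLeftB (g : DeckGroup) : deckLabel (⟨0, 1⟩ * g) = mulLeftB (deckLabel g) := by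
  have (d : ZMod 8) : cellLabel (-1 - d) = mulLeftB (cellLabel d) := by revert d; decide
  rw [DeckGroup.mk_mul_mk_of_odd (by decide), deckLabel, deckLabel, ← this]
  push_cast
  ring_nf

lemma deckLabel_mulRightA (g : DeckGroup) :
    deckLabel (g * ⟨1, 0⟩⁻¹) = mulRightA (deckLabel g) := by
  have h₀ (d : ZMod 8) : cellLabel (d + d + 1) = mulRightA (cellLabel (d + d)) := by
    revert d; decide
  have h₁ (d : ZMod 8) : cellLabel (d + d) = mulRightA (cellLabel (d + d + 1)) := by
    revert d; decide
  obtain ⟨m, n⟩ := g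
  rw [DeckGroup.inv_def, if_neg (by decide)]
  by_cases h : Even (m + n)
  · rw [DeckGroup.mk_mul_mk_of_even h]
    obtain ⟨k, hk⟩ := h
    obtain rfl : m = k + k - n := by omega
    convert h₀ (k - n) using 2 <;> push_cast [deckLabel] <;> ring_nf
  · rw [DeckGroup.mk_mul_mk_of_odd h]
    obtain ⟨k, hk⟩ := Int.not_even_iff_odd.1 h
    obtain rfl : m = 2 * k + 1 - n := by omega
    convert h₁ (k - n) using 2 <;> push_cast [deckLabel] <;> ring_nf

lemma deckLabel_mulRightB (g : DeckGroup) :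
    deckLabel (g * ⟨0, 1⟩⁻¹) = mulRightB (deckLabel g) := by
  have h₀ (d : ZMod 8) : cellLabel (d + d - 1) = mulRightB (cellLabel (d + d)) := by
    revert d; decide
  have h₁ (d : ZMod 8) : cellLabel (d + d) = mulRightB (cellLabel (d + d - 1)) := by
    revert d; decide
  obtain ⟨m, n⟩ := g
  rw [DeckGroup.inv_def, if_neg (by decide)]
  by_cases h : Even (m + n)
  · rw [DeckGroup.mk_mul_mk_of_even h]
    obtain ⟨k, hk⟩ := h
    obtain rfl : m = k + k - n := by omega
    convert h₀ (k - n) using 2 <;> push_cast [deckLabel] <;> ring_nf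
  · rw [DeckGroup.mk_mul_mk_of_odd h]
    obtain ⟨k, hk⟩ := Int.not_even_iff_odd.1 h
    obtain rfl : m = 2 * k + 1 - n := by omega
    convert h₁ (k + 1 - n) using 2 <;> push_cast [deckLabel] <;> ring_nf

noncomputable def gridPoint (N : ℕ) (p : Vertex) : (ℝ × ℝ) × (ℝ × ℝ) :=
  ((p.1 / N, p.2.1 / N), (p.2.2.1 / N, p.2.2.2 / N))

open Classical in
lemma isEquivariant_of_deckGroup_label {N : ℕ} (hN : 0 < N)
    {U : Fin 4 → Set (Klein 2 × Klein 2)} {g : Fin 4 → (ℝ × ℝ) × (ℝ × ℝ) → DeckGroup}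
    (hg : ∀ i P Q, (planeMap P, planeMap Q) ∈ U i → ∀ h k : DeckGroup,
      g i (h • P, k • Q) = h * g i (P, Q) * k⁻¹) :
    IsEquivariant N fun p i ↦
      if (planeMap (gridPoint N p).1, planeMap (gridPoint N p).2) ∈ U i
        then deckLabel (g i (gridPoint N p)) else gridLabel N p := by
  have hq := isQuotientCoveringMap_planeMap
  have hN' : (N : ℝ) ≠ 0 := by positivity
  have hgrid := isEquivariant_gridLabel hN
  have hA (P : ℝ × ℝ) : (⟨1, 0⟩ : DeckGroup) • P = (P.2 + 1, P.1) := by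
    simp [DeckGroup.smul_def]
  have hB (P : ℝ × ℝ) : (⟨0, 1⟩ : DeckGroup) • P = (P.2, P.1 + 1) := by
    simp [DeckGroup.smul_def]
  have key (p p' : Vertex) (h k : DeckGroup) (m : Heis → Heis)
      (hp : gridPoint N p' = (h • (gridPoint N p).1, k • (gridPoint N p).2))
      (hm : ∀ g, deckLabel (h * g * k⁻¹) = m (deckLabel g))
      (hm' : gridLabel N p' = m (gridLabel N p)) :
      (fun i ↦ if (planeMap (gridPoint N p').1, planeMap (gridPoint N p').2) ∈ U i
        then deckLabel (g i (gridPoint N p')) else gridLabel N p') =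
      m ∘ fun i ↦ if (planeMap (gridPoint N p).1, planeMap (gridPoint N p).2) ∈ U i
        then deckLabel (g i (gridPoint N p)) else gridLabel N p := by
    funext i
    simp only [hp, hq.map_smul, Function.comp_apply]
    split_ifs with hi
    · rw [hg i _ _ hi, hm]
    · exact hm'
  refine ⟨fun u v s t ↦ key _ _ ⟨1, 0⟩ 1 _ ?_ (fun g ↦ ?_) (congrFun (hgrid.leftA u v s t) 0),
    fun u v s t ↦ key _ _ ⟨0, 1⟩ 1 _ ?_ (fun g ↦ ?_) (congrFun (hgrid.leftB u v s t) 0),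
    fun u v s t ↦ key _ _ 1 ⟨1, 0⟩ _ ?_ (fun g ↦ ?_) (congrFun (hgrid.rightA u v s t) 0),
    fun u v s t ↦ key _ _ 1 ⟨0, 1⟩ _ ?_ (fun g ↦ ?_) (congrFun (hgrid.rightB u v s t) 0)⟩
  · simp [gridPoint, hA, add_div, hN']
  · rw [inv_one, mul_one, deckLabel_mulLeftA]
  · simp [gridPoint, hB, add_div, hN']
  · rw [inv_one, mul_one, deckLabel_mulLeftB]
  · simp [gridPoint, hA, add_div, hN']
  · rw [one_mul, deckLabel_mulRightA]
  · simp [gridPoint, hB, add_div, hN']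
  · rw [one_mul, deckLabel_mulRightB]

theorem not_hasMPCover_klein_two_four : ¬ HasMPCover (Klein 2) 4 := by
  rintro ⟨U, hU, hcov, hs⟩
  have hq := isQuotientCoveringMap_planeMap
  have hc : Continuous planeMap := hq.continuous
  choose s hs using hs
  choose g hg hg' using fun i ↦ exists_deckGroup_label (s i) (hs i)
  let A (i : Fin 4) : Set ((ℝ × ℝ) × (ℝ × ℝ)) := {p | (planeMap p.1, planeMap p.2) ∈ U i}
  have hA (i) : IsOpen (A i) := (hU i).preimage (by fun_prop)
  obtain ⟨δ, hδ, hball⟩ := lebesgue_number_lemma_of_metric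
    (isCompact_Icc (a := (((0, 0), (0, 0)) : (ℝ × ℝ) × (ℝ × ℝ))) (b := ((1, 1), (1, 1)))) hA
    fun p _ ↦ mem_iUnion.2 (iUnion_eq_univ_iff.1 hcov (planeMap p.1, planeMap p.2))
  obtain ⟨n, hn⟩ := exists_nat_one_div_lt hδ
  have hN : 0 < n + 1 := n.succ_pos
  obtain ⟨u, hu, v, hv, s, hs, t, ht, h⟩ :=
    exists_cube_not_const hN (isEquivariant_of_deckGroup_label hN hg)
  have h01 {u : ℕ} (hu : u < n + 1) : (0 : ℝ) ≤ u / (n + 1 : ℕ) ∧ (u / (n + 1 : ℕ) : ℝ) ≤ 1 :=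
    ⟨by positivity, div_le_one_of_le₀ (by exact_mod_cast hu.le) (by positivity)⟩
  obtain ⟨i, hi⟩ := hball (gridPoint (n + 1) (u, v, s, t))
    ⟨⟨⟨(h01 hu).1, (h01 hv).1⟩, (h01 hs).1, (h01 ht).1⟩,
      ⟨(h01 hu).2, (h01 hv).2⟩, (h01 hs).2, (h01 ht).2⟩
  obtain ⟨a, b, c, d, hne⟩ := h i
  have hd (u : ℕ) (a : Fin 2) :
      dist (((u + a : ℕ) : ℝ) / (n + 1 : ℕ)) (u / (n + 1 : ℕ)) < δ := by
    rw [Real.dist_eq, ← sub_div, Nat.cast_add, add_sub_cancel_left, abs_of_nonneg (by positivity)]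
    refine lt_of_le_of_lt ?_ hn
    push_cast
    gcongr
    exact_mod_cast Nat.le_of_lt_succ a.2
  have hmem : gridPoint (n + 1) (u + a, v + b, s + c, t + d)
      ∈ Metric.ball (gridPoint (n + 1) (u, v, s, t)) δ := by
    simp only [Metric.mem_ball, Prod.dist_eq, max_lt_iff]
    exact ⟨⟨hd u a, hd v b⟩, hd s c, hd t d⟩
  have hmem' := Metric.mem_ball_self (x := gridPoint (n + 1) (u, v, s, t)) hδ
  refine hne ?_
  exact (if_pos (hi hmem)).trans ((congrArg deckLabel
    (hg' i _ (convex_ball _ δ).isPreconnected (fun p hp ↦ hi hp) _ hmem _ hmem')).trans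
    (if_pos (hi hmem')).symm)

/-- The topological complexity of the 2-dimensional Klein bottle equals 5:
`K_2 × K_2` admits a motion planning cover of size 5, but none of size 4. -/
theorem tc_klein_two : HasMPCover (Klein 2) 5 ∧ ¬ HasMPCover (Klein 2) 4 :=
  ⟨hasMPCover_klein_two_five, not_hasMPCover_klein_two_four⟩

end Paper
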